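/- arXiv:1008.0713 — 3 statements merged into one kernel-verified Lean document; each statement's English description precedes it below -/
import Mathlib

section
/- For all integers m and n, ‖m+n‖ ≤ ‖m‖ + ‖n‖. -/
/-- `fnorm n` : the reciprocal of the largest `k ≥ 1` such that `1, …, k` all divide `n`,
with `fnorm 0 = 0`. -/
noncomputable def fnorm (n : ℤ) : ℝ :=
  if n = 0 then 0
  else 1 / ((sSup {k : ℕ | 1 ≤ k ∧ ∀ j : ℕ, 1 ≤ j → j ≤ k → (j : ℤ) ∣ n} : ℕ) : ℝ)

/-- The induced distance function `d(m,n) = ‖m - n‖`. -/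
noncomputable def fdist (m n : ℤ) : ℝ := fnorm (m - n)

theorem fnorm_nonneg (n : ℤ) : 0 ≤ fnorm n := by
  unfold fnorm
  split_ifs <;> positivity

theorem bddAbove_setOf_forall_le_dvd {n : ℤ} (hn : n ≠ 0) :
    BddAbove {k : ℕ | 1 ≤ k ∧ ∀ j : ℕ, 1 ≤ j → j ≤ k → (j : ℤ) ∣ n} := by
  refine ⟨n.natAbs, fun k hk => Nat.le_of_dvd (Int.natAbs_pos.mpr hn) ?_⟩
  exact Int.natCast_dvd.mp (hk.2 k hk.1 le_rfl)

/-- If `1, …, k` all divide `n`, then `‖n‖ ≤ 1 / k`. -/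
theorem fnorm_le_one_div {n : ℤ} {k : ℕ} (hk : 1 ≤ k)
    (h : ∀ j : ℕ, 1 ≤ j → j ≤ k → (j : ℤ) ∣ n) : fnorm n ≤ 1 / (k : ℝ) := by
  unfold fnorm
  split_ifs with hn
  · positivity
  · apply one_div_le_one_div_of_le
    · exact_mod_cast hk
    · exact_mod_cast le_csSup (bddAbove_setOf_forall_le_dvd hn) ⟨hk, h⟩

/-- The supremum defining `‖n‖` is attained for `n ≠ 0`. -/
theorem exists_fnorm_eq_one_div {n : ℤ} (hn : n ≠ 0) :
    ∃ k : ℕ, 1 ≤ k ∧ (∀ j : ℕ, 1 ≤ j → j ≤ k → (j : ℤ) ∣ n) ∧ fnorm n = 1 / (k : ℝ) := by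
  have hmem := Nat.sSup_mem (s := {k : ℕ | 1 ≤ k ∧ ∀ j : ℕ, 1 ≤ j → j ≤ k → (j : ℤ) ∣ n})
    ⟨1, le_rfl, fun j h1 h2 => by simp [le_antisymm h2 h1]⟩ (bddAbove_setOf_forall_le_dvd hn)
  exact ⟨_, hmem.1, hmem.2, if_neg hn⟩

/-- The norm satisfies the ultrametric inequality. -/
theorem fnorm_add_le_max (m n : ℤ) : fnorm (m + n) ≤ max (fnorm m) (fnorm n) := by
  rcases eq_or_ne m 0 with rfl | hm
  · simp
  rcases eq_or_ne n 0 with rfl | hn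
  · simp
  obtain ⟨k, hk, hkm, hm'⟩ := exists_fnorm_eq_one_div hm
  obtain ⟨l, hl, hln, hn'⟩ := exists_fnorm_eq_one_div hn
  rw [hm', hn']
  rcases le_total k l with h | h
  · exact le_max_of_le_left <| fnorm_le_one_div hk fun j h1 h2 =>
      dvd_add (hkm j h1 h2) (hln j h1 (h2.trans h))
  · exact le_max_of_le_right <| fnorm_le_one_div hl fun j h1 h2 =>
      dvd_add (hkm j h1 (h2.trans h)) (hln j h1 h2)

/-- The norm is subadditive: `‖m+n‖ ≤ ‖m‖ + ‖n‖`. -/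
theorem fnorm_add_le (m n : ℤ) : fnorm (m + n) ≤ fnorm m + fnorm n :=
  (fnorm_add_le_max m n).trans (max_le_add_of_nonneg (fnorm_nonneg m) (fnorm_nonneg n))
end

section
/- The topological space (ℤ, T), where T is the Fürstenberg topology, is totally disconnected: every connected subset of ℤ with respect to T contains at most one point. -/
/-- The arithmetic progression `a + bℤ`. -/
def ap (a : ℤ) (b : ℕ) : Set ℤ := {x : ℤ | ∃ n : ℤ, x = a + b * n}

/-- A set is open in Fürstenberg's sense if each of its points is contained
in an arithmetic progression lying inside the set. -/
def FurstOpen (A : Set ℤ) : Prop := ∀ a ∈ A, ∃ b : ℕ, 1 ≤ b ∧ ap a b ⊆ A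

/-- Fürstenberg's topology on ℤ. -/
def T : TopologicalSpace ℤ where
  IsOpen := FurstOpen
  isOpen_univ := fun a _ => ⟨1, le_refl 1, fun _ _ => trivial⟩
  isOpen_inter := by
    rintro s t hs ht a ⟨has, hat⟩
    obtain ⟨b, hb, hbs⟩ := hs a has
    obtain ⟨c, hc, hct⟩ := ht a hat
    refine ⟨b * c, Nat.one_le_iff_ne_zero.2 (Nat.mul_ne_zero (by omega) (by omega)), ?_⟩
    rintro x ⟨n, hn⟩
    exact ⟨hbs ⟨(c : ℤ) * n, by rw [hn]; push_cast; ring⟩,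
           hct ⟨(b : ℤ) * n, by rw [hn]; push_cast; ring⟩⟩
  isOpen_sUnion := by
    rintro S hS a ⟨s, hsS, has⟩
    obtain ⟨b, hb, hsub⟩ := hS s hsS a has
    exact ⟨b, hb, fun x hx => ⟨s, hsS, hsub hx⟩⟩

theorem mem_ap_iff {a x : ℤ} {b : ℕ} : x ∈ ap a b ↔ (b : ℤ) ∣ x - a :=
  exists_congr fun _ => sub_eq_iff_eq_add'.symm

theorem isClopen_ap (a : ℤ) {b : ℕ} (hb : 1 ≤ b) : @IsClopen ℤ T (ap a b) := by
  let := T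
  refine ⟨⟨fun x hx => ⟨b, hb, fun y hy hya => hx ?_⟩⟩, fun x hx => ⟨b, hb, fun y hy => ?_⟩⟩
  · rw [mem_ap_iff] at *
    simpa using dvd_sub hya hy
  · rw [mem_ap_iff] at *
    simpa using dvd_add hy hx

theorem subsingleton_of_isPreconnected {A : Set ℤ} (hA : @IsPreconnected ℤ T A) :
    A.Subsingleton := by
  let := T
  intro x hx y hy
  have hsub : A ⊆ ap x ((y - x).natAbs + 1) :=
    hA.subset_isClopen (isClopen_ap x (Nat.le_add_left 1 _))
      ⟨x, hx, mem_ap_iff.2 (by simp)⟩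
  have hdvd := mem_ap_iff.1 (hsub hy)
  have hzero := Int.eq_zero_of_abs_lt_dvd hdvd (by push_cast; omega)
  omega

/-- `(ℤ, T)` is totally disconnected: every (pre)connected subset has at most one point. -/
theorem furstenberg_totallyDisconnected :
    @TotallyDisconnectedSpace ℤ T ∧
    ∀ A : Set ℤ, @IsPreconnected ℤ T A → A.Subsingleton := by
  exact ⟨@TotallyDisconnectedSpace.mk ℤ T fun _ _ hA => subsingleton_of_isPreconnected hA,
    fun _ hA => subsingleton_of_isPreconnected hA⟩
end

section
/- If A ⊆ ℤ contains two distinct elements a and b, then A is not connected in the Fürstenberg topology T: for any integer k ≥ 1 that does not divide b − a, the sets A ∩ (a + kℤ) and A ∩ ⋃_{j=1}^{k−1}(a + j + kℤ) are nonempty disjoint relatively open subsets of A whose union is A. -/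
theorem mem_ap_iff_dvd {a x : ℤ} {k : ℕ} : x ∈ ap a k ↔ (k : ℤ) ∣ x - a :=
  exists_congr fun _ => sub_eq_iff_eq_add'.symm

theorem isOpen_ap (a : ℤ) {k : ℕ} (hk : 1 ≤ k) : T.IsOpen (ap a k) := by
  rintro x ⟨m, rfl⟩
  refine ⟨k, hk, ?_⟩
  rintro y ⟨n, rfl⟩
  exact ⟨m + n, by ring⟩

theorem iUnion_ap_add_eq_compl (a : ℤ) {k : ℕ} (hk : 1 ≤ k) :
    ⋃ j ∈ Finset.Icc 1 (k - 1), ap (a + (j : ℤ)) k = (ap a k)ᶜ := by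
  ext x
  simp only [Set.mem_iUnion, Finset.mem_Icc, Set.mem_compl_iff, mem_ap_iff_dvd, exists_prop]
  constructor
  · rintro ⟨j, ⟨hj, hjk⟩, hx⟩ hxa
    have hdvd : (k : ℤ) ∣ (j : ℤ) := by
      have h := dvd_sub hxa hx
      rwa [show x - a - (x - (a + j)) = (j : ℤ) by ring] at h
    have := Nat.le_of_dvd hj (Int.natCast_dvd_natCast.mp hdvd)
    omega
  · intro hx
    have hk0 : (0 : ℤ) < k := by exact_mod_cast hk
    have hnonneg := Int.emod_nonneg (x - a) hk0.ne'
    have hlt := Int.emod_lt_of_pos (x - a) hk0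
    have hne : (x - a) % k ≠ 0 := fun h => hx (Int.dvd_of_emod_eq_zero h)
    refine ⟨((x - a) % k).toNat, by omega, ?_⟩
    rw [Int.toNat_of_nonneg hnonneg, ← sub_sub]
    exact Int.dvd_self_sub_emod

theorem isOpen_iUnion_ap_add (a : ℤ) {k : ℕ} (hk : 1 ≤ k) :
    T.IsOpen (⋃ j ∈ Finset.Icc 1 (k - 1), ap (a + (j : ℤ)) k) :=
  @isOpen_biUnion _ _ T _ _ fun j _ => isOpen_ap (a + (j : ℤ)) hk

/-- If `A ⊆ ℤ` contains two distinct points `a, b`, then for any `k ≥ 1` not dividing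
`b - a`, the sets `A ∩ (a + kℤ)` and `A ∩ ⋃_{j=1}^{k-1} (a + j + kℤ)` are nonempty
disjoint relatively open subsets of `A` covering `A`; hence `A` is not connected. -/
theorem not_connected_of_two_points (A : Set ℤ) (a b : ℤ)
    (ha : a ∈ A) (hb : b ∈ A) (hab : a ≠ b)
    (k : ℕ) (hk : 1 ≤ k) (hdvd : ¬ (k : ℤ) ∣ (b - a)) :
    (A ∩ ap a k).Nonempty ∧
    (A ∩ ⋃ j ∈ Finset.Icc 1 (k - 1), ap (a + (j : ℤ)) k).Nonempty ∧
    (A ∩ ap a k) ∩ (A ∩ ⋃ j ∈ Finset.Icc 1 (k - 1), ap (a + (j : ℤ)) k) = ∅ ∧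
    (A ∩ ap a k) ∪ (A ∩ ⋃ j ∈ Finset.Icc 1 (k - 1), ap (a + (j : ℤ)) k) = A ∧
    T.IsOpen (ap a k) ∧
    T.IsOpen (⋃ j ∈ Finset.Icc 1 (k - 1), ap (a + (j : ℤ)) k) ∧
    ¬ @IsPreconnected ℤ T A := by
  have hopen := isOpen_iUnion_ap_add a hk
  rw [iUnion_ap_add_eq_compl a hk] at hopen ⊢
  have hA : (A ∩ ap a k).Nonempty := ⟨a, ha, mem_ap_iff_dvd.mpr (by simp)⟩
  have hAc : (A ∩ (ap a k)ᶜ).Nonempty := ⟨b, hb, fun h => hdvd (mem_ap_iff_dvd.mp h)⟩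
  refine ⟨hA, hAc, ?_, Set.inter_union_compl A _, isOpen_ap a hk, hopen, fun h => ?_⟩
  · rw [← Set.inter_inter_distrib_left, Set.inter_compl_self, Set.inter_empty]
  · obtain ⟨x, -, hx, hxc⟩ := h _ _ (isOpen_ap a hk) hopen (by simp) hA hAc
    exact hxc hx
end
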